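/- arXiv:math/0301341 — 2 statements merged into one kernel-verified Lean document; each statement's English description precedes it below -/
import Mathlib

section
/- Let n ≥ 1, let Ω ⊆ ℝⁿ be an open neighbourhood of 0, let b : Ω → ℝⁿ be smooth with b(0) = 0 and Db(0) = 0 (so b(z) = O(‖z‖²)), and let f : Ω → ℂ be smooth with f(0) = 0. Then there exists r > 0 with the open ball B(0,r) ⊆ Ω and a smooth function a : B(0,r) → ℂ such that a(0) = 1 and Σ_{i=1}^{n} (z_i + b_i(z))·∂a/∂z_i(z) = f(z)·a(z) for all z ∈ B(0,r); moreover any two smooth solutions of this equation on B(0,r) taking the value 1 at 0 agree on some smaller ball B(0,r'). -/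
open Set

open scoped ContDiff Topology unitInterval

section Superposition

variable {X : Type*} [TopologicalSpace X] [CompactSpace X]
  {E F : Type*} [NormedAddCommGroup E] [NormedSpace ℝ E] [NormedAddCommGroup F] [NormedSpace ℝ F]

/-- The pointwise application of a continuous family of operators to a continuous function. -/
noncomputable def pointwiseApply : C(X, E →L[ℝ] F) →L[ℝ] C(X, E) →L[ℝ] C(X, F) :=
  LinearMap.mkContinuous₂
    (LinearMap.mk₂ ℝ (fun (A : C(X, E →L[ℝ] F)) (h : C(X, E)) =>
        (⟨fun x => A x (h x), by fun_prop⟩ : C(X, F)))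
      (fun _ _ _ => by ext; simp) (fun _ _ _ => by ext; simp)
      (fun _ _ _ => by ext; simp) (fun _ _ _ => by ext; simp)) 1
    (fun A h => (ContinuousMap.norm_le _ (by positivity)).2 fun x => by
      have := (A x).le_of_opNorm_le_of_le (A.norm_coe_le_norm x) (h.norm_coe_le_norm x)
      simpa using this)

@[simp]
theorem pointwiseApply_apply (A : C(X, E →L[ℝ] F)) (h : C(X, E)) (x : X) :
    pointwiseApply A h x = A x (h x) := rfl

/-- The superposition operator of a `C¹` function on continuous functions on a compact space is
differentiable. -/
theorem hasFDerivAt_superposition {f : E → F} (hf : ContDiff ℝ 1 f) (u : C(X, E)) :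
    HasFDerivAt (fun v : C(X, E) => (⟨f, hf.continuous⟩ : C(E, F)).comp v)
      (pointwiseApply
        ((⟨fderiv ℝ f, hf.continuous_fderiv one_ne_zero⟩ : C(E, E →L[ℝ] F)).comp u)) u := by
  set f' : C(E, E →L[ℝ] F) := ⟨fderiv ℝ f, hf.continuous_fderiv one_ne_zero⟩ with hf'
  refine HasFDerivAt.of_isLittleO (Asymptotics.isLittleO_iff.2 fun ε hε => ?_)
  have hcont : Continuous fun v : C(X, E) => f'.comp v := ContinuousMap.continuous_postcomp f'
  obtain ⟨δ, hδ, hclose⟩ := (Metric.continuousAt_iff (α := C(X, E))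
    (β := C(X, E →L[ℝ] F))).1 hcont.continuousAt ε hε
  filter_upwards [Metric.ball_mem_nhds u hδ] with v hv
  refine (ContinuousMap.norm_le _ (by positivity)).2 fun x => ?_
  have hx : v x ∈ Metric.ball (u x) δ := (ContinuousMap.dist_apply_le_dist x).trans_lt hv
  have key := (convex_ball (u x) δ).norm_image_sub_le_of_norm_hasFDerivWithin_le'
    (f := f) (f' := fderiv ℝ f) (φ := fderiv ℝ f (u x)) (C := ε)
    (fun y _ => ((hf.differentiable one_ne_zero) y).hasFDerivAt.hasFDerivWithinAt)
    (fun y hy => ?_) (Metric.mem_ball_self hδ) hx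
  · simpa [hf'] using key.trans
      (mul_le_mul_of_nonneg_left ((v - u).norm_coe_le_norm x) hε.le)
  · have hshift : dist (u + ContinuousMap.const X (y - u x)) u < δ := by
      rw [dist_eq_norm, add_sub_cancel_left]
      refine (ContinuousMap.norm_lt_iff _ hδ).2 fun _ => ?_
      simpa [dist_eq_norm] using hy
    have := (ContinuousMap.dist_apply_le_dist x).trans_lt (hclose hshift)
    simpa [hf', dist_eq_norm] using this.le

end Superposition

universe u

/-- The superposition operator of a `C^k` function is `C^k` on the space of continuous functions
on a compact space. -/
theorem contDiff_superposition_nat {X : Type*} [TopologicalSpace X] [CompactSpace X]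
    {E : Type u} [NormedAddCommGroup E] [NormedSpace ℝ E] (k : ℕ) :
    ∀ {F : Type u} [NormedAddCommGroup F] [NormedSpace ℝ F] {f : E → F} (hf : ContDiff ℝ k f),
    ContDiff ℝ k (fun v : C(X, E) => (⟨f, hf.continuous⟩ : C(E, F)).comp v) := by
  induction k with
  | zero =>
    intro F _ _ f hf
    exact contDiff_zero.2 (ContinuousMap.continuous_postcomp _)
  | succ k ih =>
    intro F _ _ f hf
    have hf1 : ContDiff ℝ 1 f := hf.of_le (by simp)
    refine contDiff_succ_iff_hasFDerivAt.2 ⟨_, ?_, hasFDerivAt_superposition hf1⟩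
    exact pointwiseApply.contDiff.comp (ih (hf.fderiv_right (m := k) (by simp)))

/-- The superposition operator of a smooth function is smooth on the space of continuous functions
on a compact space. -/
theorem contDiff_superposition {X : Type*} [TopologicalSpace X] [CompactSpace X]
    {E F : Type u} [NormedAddCommGroup E] [NormedSpace ℝ E] [NormedAddCommGroup F]
    [NormedSpace ℝ F] {f : E → F} (hf : ContDiff ℝ ∞ f) :
    ContDiff ℝ ∞ (fun v : C(X, E) => (⟨f, hf.continuous⟩ : C(E, F)).comp v) :=
  contDiff_infty.2 fun k => contDiff_superposition_nat k (contDiff_infty.1 hf k)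

section Primitive

variable {F : Type*} [NormedAddCommGroup F] [NormedSpace ℝ F]

omit [NormedSpace ℝ F] in
theorem intervalIntegrable_IccExtend (v : C(I, F)) (a b : ℝ) :
    IntervalIntegrable (IccExtend zero_le_one v) MeasureTheory.volume a b :=
  (v.continuous.Icc_extend' (h := zero_le_one)).intervalIntegrable a b

/-- The primitive vanishing at `1` of a continuous function on the unit interval. -/
noncomputable def primitiveFromOne : C(I, F) →L[ℝ] C(I, F) :=
  LinearMap.mkContinuous
    { toFun := fun v => ⟨fun s => ∫ t in (1 : ℝ)..s, IccExtend zero_le_one v t,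
        (intervalIntegral.continuous_primitive (intervalIntegrable_IccExtend v) 1).comp
          continuous_subtype_val⟩
      map_add' := fun v w => by
        ext s
        exact intervalIntegral.integral_add (intervalIntegrable_IccExtend v 1 s)
          (intervalIntegrable_IccExtend w 1 s)
      map_smul' := fun c v => by
        ext s
        exact intervalIntegral.integral_smul c _ } 1
    (fun v => (ContinuousMap.norm_le _ (by positivity)).2 fun s => by
      have := intervalIntegral.norm_integral_le_of_norm_le_const (a := 1) (b := (s : ℝ))
        (f := IccExtend zero_le_one v) (C := ‖v‖) (fun t _ => v.norm_coe_le_norm _)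
      refine this.trans ?_
      rw [one_mul]
      refine mul_le_of_le_one_right (norm_nonneg _) ?_
      rw [abs_le]
      constructor <;> linarith [s.2.1, s.2.2])

theorem primitiveFromOne_apply (v : C(I, F)) (s : I) :
    primitiveFromOne v s = ∫ t in (1 : ℝ)..s, IccExtend zero_le_one v t := rfl

end Primitive

/-- Hadamard's lemma: a smooth function vanishing at the origin factors smoothly through the
identity. -/
theorem exists_contDiff_apply_self {E F : Type u} [NormedAddCommGroup E] [NormedSpace ℝ E]
    [NormedAddCommGroup F] [NormedSpace ℝ F] [CompleteSpace F] {f : E → F}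
    (hf : ContDiff ℝ ∞ f) (hf0 : f 0 = 0) :
    ∃ H : E → E →L[ℝ] F, ContDiff ℝ ∞ H ∧ (∀ x, f x = H x x) ∧ H 0 = fderiv ℝ f 0 := by
  have hdf : ContDiff ℝ ∞ (fderiv ℝ f) := hf.fderiv_right (by simp)
  let f' : C(E, E →L[ℝ] F) := ⟨fderiv ℝ f, hdf.continuous⟩
  let ray : E →L[ℝ] C(I, E) :=
    LinearMap.mkContinuous
      { toFun := fun x => (⟨fun s => (s : ℝ) • x, by fun_prop⟩ : C(I, E))
        map_add' := fun x y => by ext; simp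
        map_smul' := fun c x => by ext s; simp [smul_comm c (s : ℝ) x] } 1
      (fun x => (ContinuousMap.norm_le _ (by positivity)).2 fun s => by
        have : |(s : ℝ)| ≤ 1 := abs_le.2 ⟨by linarith [s.2.1], s.2.2⟩
        simpa [norm_smul] using mul_le_of_le_one_left (norm_nonneg x) this)
  have hray : ∀ x s, ray x s = (s : ℝ) • x := fun _ _ => rfl
  let avg : C(I, E →L[ℝ] F) →L[ℝ] (E →L[ℝ] F) :=
    -(ContinuousMap.evalCLM ℝ (0 : I)).comp primitiveFromOne
  have havg : ∀ v : C(I, E →L[ℝ] F), avg v = ∫ t in (0 : ℝ)..1, IccExtend zero_le_one v t := by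
    intro v
    rw [intervalIntegral.integral_symm]
    rfl
  refine ⟨fun x => avg (f'.comp (ray x)),
    avg.contDiff.comp ((contDiff_superposition hdf).comp ray.contDiff), fun x => ?_, ?_⟩
  · have hderiv : ∀ t ∈ uIcc (0 : ℝ) 1,
        HasDerivAt (fun t : ℝ => f (t • x)) (fderiv ℝ f (t • x) x) t := fun t _ => by
      have h1 : HasDerivAt (fun t : ℝ => t • x) x t := by
        simpa using (hasDerivAt_id t).smul_const x
      exact ((hf.differentiable (by simp)) (t • x)).hasFDerivAt.comp_hasDerivAt t h1
    have hcont : Continuous fun t : ℝ => fderiv ℝ f (t • x) :=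
      hdf.continuous.comp (by fun_prop)
    have hftc := intervalIntegral.integral_eq_sub_of_hasDerivAt hderiv
      ((hcont.clm_apply continuous_const).intervalIntegrable 0 1)
    rw [one_smul, zero_smul, hf0, sub_zero] at hftc
    rw [← hftc, ← ContinuousLinearMap.intervalIntegral_apply (hcont.intervalIntegrable 0 1)]
    beta_reduce
    rw [havg]
    congr 1
    refine intervalIntegral.integral_congr fun t ht => ?_
    rw [uIcc_of_le zero_le_one] at ht
    simp [IccExtend_of_mem _ _ ht, f', hray]
  · beta_reduce
    rw [havg]
    have : IccExtend zero_le_one (f'.comp (ray 0)) = fun _ => fderiv ℝ f 0 := by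
      funext t
      simp [IccExtend, f']
    rw [this]
    simp

section TimeSuperposition

variable {E F : Type u} [NormedAddCommGroup E] [NormedSpace ℝ E]
  [NormedAddCommGroup F] [NormedSpace ℝ F]

/-- The superposition operator of a time-dependent function, acting on curves. -/
def timeSuperposition (G : C(ℝ × E, F)) (v : C(I, E)) : C(I, F) :=
  ⟨fun s => G (s, v s), by fun_prop⟩

omit [NormedSpace ℝ F] in
theorem timeSuperposition_eq (G : C(ℝ × E, F)) :
    timeSuperposition G = fun v : C(I, E) => G.comp
      ((⟨fun s => ((s : ℝ), (0 : E)), by fun_prop⟩ : C(I, ℝ × E)) +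
        (ContinuousLinearMap.inr ℝ ℝ E).compLeftContinuous ℝ I v) := by
  funext v
  ext s
  simp [timeSuperposition]

theorem contDiff_timeSuperposition {G : C(ℝ × E, F)} (hG : ContDiff ℝ ∞ G) :
    ContDiff ℝ ∞ (timeSuperposition G) := by
  rw [timeSuperposition_eq]
  exact (contDiff_superposition hG).comp
    (contDiff_const.add (ContinuousLinearMap.contDiff _))

theorem hasFDerivAt_timeSuperposition_zero {G : C(ℝ × E, F)} (hG : ContDiff ℝ 1 G) {v : C(I, E)}
    (h : ∀ (s : I) (y : E), fderiv ℝ G (s, v s) (0, y) = 0) :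
    HasFDerivAt (timeSuperposition G) (0 : C(I, E) →L[ℝ] C(I, F)) v := by
  rw [timeSuperposition_eq]
  have hcomp := (hasFDerivAt_superposition hG _).comp v
    (((ContinuousLinearMap.inr ℝ ℝ E).compLeftContinuous ℝ I).hasFDerivAt.const_add
      (⟨fun s => ((s : ℝ), (0 : E)), by fun_prop⟩ : C(I, ℝ × E)))
  refine hcomp.congr_fderiv ?_
  ext y s
  simpa using h s (y s)

end TimeSuperposition

section Rays

variable {E : Type u} [NormedAddCommGroup E] [NormedSpace ℝ E]

/-- Integral form of the equation `v'(s) = K(s v(s)) v(s) v(s)`, which says that `s ↦ s • v(s)` is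
an integral curve of `x ↦ x + K(x) x x` in the logarithmic time `log s`. -/
def IsRay (K : E → E →L[ℝ] E →L[ℝ] E) (v : C(I, E)) : Prop :=
  ∀ s : I, v s = v 1 + ∫ t in (1 : ℝ)..s,
    K (t • IccExtend zero_le_one v t) (IccExtend zero_le_one v t) (IccExtend zero_le_one v t)

/-- Every point near the origin is the endpoint of exactly one small ray, which depends smoothly on
that point. -/
theorem exists_contDiffOn_isRay [CompleteSpace E] {K : E → E →L[ℝ] E →L[ℝ] E}
    (hK : ContDiff ℝ ∞ K) :
    ∃ ρ > (0 : ℝ), ∃ δ > (0 : ℝ), ∃ u : E → C(I, E),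
      ContDiffOn ℝ ∞ u (Metric.ball 0 ρ) ∧ u 0 = 0 ∧
      (∀ z ∈ Metric.ball (0 : E) ρ, ‖u z‖ < δ ∧ IsRay K (u z) ∧ u z 1 = z) ∧
      ∀ v : C(I, E), ‖v‖ < δ → IsRay K v → u (v 1) = v := by
  have hGs : ContDiff ℝ ∞ fun p : ℝ × E => K (p.1 • p.2) p.2 p.2 :=
    ((hK.comp (contDiff_fst.smul contDiff_snd)).clm_apply contDiff_snd).clm_apply contDiff_snd
  let G : C(ℝ × E, E) := ⟨fun p => K (p.1 • p.2) p.2 p.2, hGs.continuous⟩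
  have hG : ContDiff ℝ ∞ G := hGs
  have hG0 : ∀ (s : I) (y : E), fderiv ℝ G ((s : ℝ), (0 : C(I, E)) s) (0, y) = 0 := by
    intro s y
    have hline : HasDerivAt (fun t : ℝ => ((s : ℝ), t • y)) ((0 : ℝ), y) 0 :=
      (hasDerivAt_const (0 : ℝ) (s : ℝ)).prodMk
        (by simpa using (hasDerivAt_id (0 : ℝ)).smul_const y)
    have h1 : HasDerivAt (fun t : ℝ => G ((s : ℝ), t • y))
        (fderiv ℝ G ((s : ℝ), (0 : ℝ) • y) (0, y)) 0 :=
      ((hG.differentiable (by simp)) _).hasFDerivAt.comp_hasDerivAt (0 : ℝ) hline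
    have hk : Differentiable ℝ fun t : ℝ => t • K ((s : ℝ) • t • y) y y :=
      (ContDiff.differentiable (n := ∞) (contDiff_id.smul
        (((hK.comp (contDiff_const.smul (contDiff_id.smul contDiff_const))).clm_apply
          contDiff_const).clm_apply contDiff_const)) (by simp))
    have h2 := (hasDerivAt_id (0 : ℝ)).smul (hk 0).hasDerivAt
    have h3 : (fun t : ℝ => G ((s : ℝ), t • y)) =
        fun t : ℝ => t • (t • K ((s : ℝ) • t • y) y y) := by
      funext t
      simp [G]
    rw [h3] at h1
    simpa using h1.unique h2
  let Φ : C(I, E) → C(I, E) := fun v => v - primitiveFromOne (timeSuperposition G v)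
  have hΦ : ContDiff ℝ ∞ Φ :=
    contDiff_id.sub ((primitiveFromOne (F := E)).contDiff.comp (contDiff_timeSuperposition hG))
  have hΦ0 : Φ 0 = 0 := by
    have : timeSuperposition G 0 = 0 := by
      ext s
      simp [timeSuperposition, G]
    simp [Φ, this]
  have hΦ' : HasFDerivAt Φ
      ((ContinuousLinearEquiv.refl ℝ C(I, E) : C(I, E) ≃L[ℝ] C(I, E)) :
        C(I, E) →L[ℝ] C(I, E)) 0 := by
    have := (hasFDerivAt_id (𝕜 := ℝ) (0 : C(I, E))).sub
      (primitiveFromOne.hasFDerivAt.comp (0 : C(I, E))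
        (hasFDerivAt_timeSuperposition_zero (hG.of_le (by simp)) hG0))
    refine this.congr_fderiv ?_
    ext
    simp
  have hext : ∀ (v : C(I, E)) (s : I), primitiveFromOne (timeSuperposition G v) s =
      ∫ t in (1 : ℝ)..s, K (t • IccExtend zero_le_one v t) (IccExtend zero_le_one v t)
        (IccExtend zero_le_one v t) := by
    intro v s
    refine intervalIntegral.integral_congr fun t ht => ?_
    have ht' : t ∈ Icc (0 : ℝ) 1 := by
      rw [uIcc_of_ge s.2.2] at ht
      exact ⟨s.2.1.trans ht.1, ht.2⟩
    simp [IccExtend_of_mem _ _ ht', timeSuperposition, G]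
  let e := hΦ.contDiffAt.toOpenPartialHomeomorph Φ hΦ' (by simp)
  have he : (e : C(I, E) → C(I, E)) = Φ := rfl
  have hsource : (0 : C(I, E)) ∈ e.source :=
    hΦ.contDiffAt.mem_toOpenPartialHomeomorph_source hΦ' (by simp)
  have hinv : ∀ᶠ v in 𝓝 (0 : C(I, E)), fderiv ℝ Φ v ∈
      range ((↑) : (C(I, E) ≃L[ℝ] C(I, E)) → C(I, E) →L[ℝ] C(I, E)) := by
    refine (hΦ.continuous_fderiv (by simp)).continuousAt.eventually_mem ?_
    rw [hΦ'.fderiv]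
    exact ContinuousLinearEquiv.nhds _
  obtain ⟨δ, hδ, hδsub⟩ := Metric.mem_nhds_iff.1
    (Filter.inter_mem (e.open_source.mem_nhds hsource) hinv)
  let cst : E →L[ℝ] C(I, E) :=
    LinearMap.mkContinuous
      { toFun := fun z => ContinuousMap.const I z
        map_add' := fun _ _ => rfl
        map_smul' := fun _ _ => rfl } 1
      (fun z => (ContinuousMap.norm_le _ (by positivity)).2 fun s => (one_mul ‖z‖).ge)
  have hcst : ∀ z s, cst z s = z := fun _ _ => rfl
  have htarget : (0 : C(I, E)) ∈ e.target := by
    have := e.map_source hsource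
    rwa [he, hΦ0] at this
  have hsymm0 : e.symm 0 = 0 := by
    have := e.left_inv hsource
    rwa [he, hΦ0] at this
  have hnear : ∀ᶠ z in 𝓝 (0 : E), cst z ∈ e.target ∧ e.symm (cst z) ∈ Metric.ball 0 δ := by
    have hc : Filter.Tendsto cst (𝓝 0) (𝓝 0) := by
      simpa using cst.continuous.tendsto 0
    have hball : ∀ᶠ v in 𝓝 0, e.symm v ∈ Metric.ball 0 δ := by
      refine (e.continuousAt_symm htarget).eventually_mem ?_
      rw [hsymm0]
      exact Metric.ball_mem_nhds _ hδ
    exact hc.eventually ((e.open_target.eventually_mem htarget).and hball)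
  obtain ⟨ρ, hρ, hρsub⟩ := Metric.mem_nhds_iff.1 hnear
  refine ⟨ρ, hρ, δ, hδ, fun z => e.symm (cst z), fun z hz => ?_, by simpa using hsymm0,
    fun z hz => ?_, fun v hv hray => ?_⟩
  · obtain ⟨hzt, hzb⟩ := hρsub hz
    obtain ⟨L, hL⟩ := (hδsub hzb).2
    refine ContDiffAt.contDiffWithinAt (ContDiffAt.comp z ?_ cst.contDiff.contDiffAt)
    refine e.contDiffAt_symm hzt (f₀' := L) ?_ hΦ.contDiffAt
    rw [hL]
    exact ((hΦ.differentiable (by simp)) _).hasFDerivAt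
  · obtain ⟨hzt, hzb⟩ := hρsub hz
    have hsol : Φ (e.symm (cst z)) = cst z := e.right_inv hzt
    have hpt : ∀ s : I, e.symm (cst z) s = z + primitiveFromOne
        (timeSuperposition G (e.symm (cst z))) s := fun s => by
      have := DFunLike.congr_fun hsol s
      rw [hcst] at this
      exact sub_eq_iff_eq_add.1 this
    have hone : e.symm (cst z) 1 = z := by
      rw [hpt, hext]
      simp
    refine ⟨by simpa using hzb, fun s => ?_, hone⟩
    rw [hone, hpt, hext]
  · have : Φ v = cst (v 1) := by
      ext s
      simp [Φ, hext, hcst, sub_eq_iff_eq_add, ← hray s]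
    beta_reduce
    rw [← this]
    exact e.left_inv (hδsub (by simpa using hv)).1

variable {K : E → E →L[ℝ] E →L[ℝ] E}

/-- The curve swept out by a ray solves the rescaled flow equation. -/
theorem IsRay.exists_curve [CompleteSpace E] (hK : Continuous K) {v : C(I, E)} (hv : IsRay K v) :
    ∃ c : ℝ → E, (∀ s ∈ Icc (0 : ℝ) 1, c s = s • IccExtend zero_le_one v s) ∧
      ∀ s ∈ Icc (0 : ℝ) 1, ∃ c' : E, HasDerivAt c c' s ∧ s • c' = c s + K (c s) (c s) (c s) := by
  set V : ℝ → E := IccExtend zero_le_one v with hVdef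
  have hV : Continuous V := v.continuous.Icc_extend' (h := zero_le_one)
  have hrhs : Continuous fun t : ℝ => K (t • V t) (V t) (V t) :=
    ((hK.comp (continuous_id.smul hV)).clm_apply hV).clm_apply hV
  set W : ℝ → E := fun s => v 1 + ∫ t in (1 : ℝ)..s, K (t • V t) (V t) (V t)
  have hVW : ∀ s ∈ Icc (0 : ℝ) 1, W s = V s := fun s hs => by
    rw [hVdef, IccExtend_of_mem _ _ hs]
    exact (hv ⟨s, hs⟩).symm
  have hc : ∀ s ∈ Icc (0 : ℝ) 1, s • W s = s • V s := fun s hs => by rw [hVW s hs]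
  refine ⟨fun s => s • W s, hc, fun s hs => ?_⟩
  have hW' : HasDerivAt W (K (s • V s) (V s) (V s)) s :=
    (intervalIntegral.integral_hasDerivAt_right (hrhs.intervalIntegrable _ _)
      (hrhs.stronglyMeasurableAtFilter _ _) hrhs.continuousAt).const_add _
  refine ⟨_, (hasDerivAt_id s).smul hW', ?_⟩
  simp only [id, hVW s hs, map_smul, smul_apply, one_smul, smul_add]
  rw [add_comm]

/-- Rescaling a ray gives the ray of an intermediate point. -/
theorem IsRay.exists_rescale (hK : Continuous K) {v : C(I, E)} (hv : IsRay K v) {l : ℝ}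
    (hl : l ∈ Icc (0 : ℝ) 1) :
    ∃ w : C(I, E), IsRay K w ∧ ‖w‖ ≤ ‖v‖ ∧
      ∀ s : I, w s = l • IccExtend zero_le_one v (l * s) := by
  have hV : Continuous (IccExtend zero_le_one v) := v.continuous.Icc_extend' (h := zero_le_one)
  let w : C(I, E) := ⟨fun s => l • IccExtend zero_le_one v (l * s), by fun_prop⟩
  have hmem : ∀ s ∈ Icc (0 : ℝ) 1, l * s ∈ Icc (0 : ℝ) 1 := fun s hs =>
    ⟨mul_nonneg hl.1 hs.1, mul_le_one₀ hl.2 hs.1 hs.2⟩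
  refine ⟨w, fun s => ?_, ?_, fun s => rfl⟩
  · set V : ℝ → E := IccExtend zero_le_one v with hVdef
    set R : ℝ → E := fun t => K (t • V t) (V t) (V t) with hR
    have hw1 : w 1 = l • V l := by simp [w, hVdef]
    have hint : ∫ t in (1 : ℝ)..s, K (t • IccExtend zero_le_one w t) (IccExtend zero_le_one w t)
        (IccExtend zero_le_one w t) = l • ∫ t in l..l * s, R t := by
      have hcomp := intervalIntegral.smul_integral_comp_mul_left (a := 1) (b := (s : ℝ)) R l
      rw [mul_one] at hcomp
      rw [← hcomp, smul_smul, ← intervalIntegral.integral_smul]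
      refine intervalIntegral.integral_congr fun t ht => ?_
      have ht' : t ∈ Icc (0 : ℝ) 1 := by
        rw [uIcc_of_ge s.2.2] at ht
        exact ⟨s.2.1.trans ht.1, ht.2⟩
      have hwt : IccExtend zero_le_one w t = l • V (l * t) := IccExtend_of_mem _ _ ht'
      simp only [hwt, hR, map_smul, smul_apply, smul_smul]
      rw [mul_comm t l]
    have hsplit : V (l * s) = V l + ∫ t in l..l * s, R t := by
      have hR_int : ∀ a b, IntervalIntegrable R MeasureTheory.volume a b := fun a b =>
        (((hK.comp (continuous_id.smul hV)).clm_apply hV).clm_apply hV).intervalIntegrable a b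
      have hVR : ∀ t ∈ Icc (0 : ℝ) 1, V t = v 1 + ∫ x in (1 : ℝ)..t, R x := fun t ht => by
        rw [hVdef, IccExtend_of_mem _ _ ht]
        exact hv ⟨t, ht⟩
      rw [hVR _ (hmem s s.2), hVR l hl, add_assoc,
        intervalIntegral.integral_add_adjacent_intervals (hR_int _ _) (hR_int _ _)]
    rw [hw1, hint, ← smul_add, ← hsplit]
    rfl
  · refine (ContinuousMap.norm_le _ (norm_nonneg _)).2 fun s => ?_
    calc ‖w s‖ = |l| * ‖IccExtend zero_le_one v (l * s)‖ := norm_smul _ _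
      _ ≤ 1 * ‖v‖ := mul_le_mul (abs_le.2 ⟨by linarith [hl.1], hl.2⟩) (v.norm_coe_le_norm _)
          (norm_nonneg _) zero_le_one
      _ = ‖v‖ := one_mul _

end Rays

/-- The logarithm of the solution of the transport equation `da(z)(z + b(z)) = f(z) a(z)`: it is
smooth near the origin, and its exponential is the only normalized solution there. -/
theorem exists_transport_phase {E : Type} [NormedAddCommGroup E] [NormedSpace ℝ E]
    [CompleteSpace E] {b : E → E} {f : E → ℂ} (hb : ContDiff ℝ ∞ b) (hb0 : b 0 = 0)
    (hDb : fderiv ℝ b 0 = 0) (hf : ContDiff ℝ ∞ f) (hf0 : f 0 = 0) :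
    ∃ ρ > (0 : ℝ), ∃ g : E → ℂ, ContDiffOn ℝ ∞ g (Metric.ball 0 ρ) ∧ g 0 = 0 ∧
      (∀ z ∈ Metric.ball (0 : E) ρ, fderiv ℝ g z (z + b z) = f z) ∧
      ∀ r > (0 : ℝ), ∃ r' > (0 : ℝ), r' ≤ r ∧ ∀ a : E → ℂ,
        DifferentiableOn ℝ a (Metric.ball 0 r) → a 0 = 1 →
        (∀ z ∈ Metric.ball (0 : E) r, fderiv ℝ a z (z + b z) = f z * a z) →
        ∀ z ∈ Metric.ball (0 : E) r', a z = Complex.exp (g z) := by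
  obtain ⟨B, hB, hbB, hB0⟩ := exists_contDiff_apply_self hb hb0
  obtain ⟨K, hK, hBK, -⟩ := exists_contDiff_apply_self hB (hB0.trans hDb)
  obtain ⟨H, hH, hfH, -⟩ := exists_contDiff_apply_self hf hf0
  have hbK : ∀ x, b x = K x x x := fun x => by rw [hbB, hBK]
  obtain ⟨ρ, hρ, δ, hδ, u, hu, hu0, hray, huniq⟩ := exists_contDiffOn_isRay hK
  have hPs : ContDiff ℝ ∞ fun p : ℝ × E => H (p.1 • p.2) p.2 :=
    (hH.comp (contDiff_fst.smul contDiff_snd)).clm_apply contDiff_snd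
  let P : C(ℝ × E, ℂ) := ⟨fun p => H (p.1 • p.2) p.2, hPs.continuous⟩
  let ψ : C(I, E) → ℝ → ℂ := fun v t => P (t, IccExtend zero_le_one v t)
  have hψ : ∀ v, Continuous (ψ v) := fun v =>
    P.continuous.comp (continuous_id.prodMk (v.continuous.Icc_extend' (h := zero_le_one)))
  have hψf : ∀ (v : C(I, E)) (t : ℝ), (t : ℂ) * ψ v t =
      f (t • IccExtend zero_le_one v t) := fun v t => by
    rw [hfH, map_smul, Complex.real_smul]
    rfl
  let avg : C(I, ℂ) →L[ℝ] ℂ := -(ContinuousMap.evalCLM ℝ (0 : I)).comp primitiveFromOne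
  have havg : ∀ v : C(I, E), avg (timeSuperposition P v) = ∫ t in (0 : ℝ)..1, ψ v t := by
    intro v
    have : avg (timeSuperposition P v) =
        ∫ t in (0 : ℝ)..1, IccExtend zero_le_one (timeSuperposition P v) t := by
      rw [intervalIntegral.integral_symm]
      rfl
    rw [this]
    refine intervalIntegral.integral_congr fun t ht => ?_
    rw [uIcc_of_le zero_le_one] at ht
    simp [ψ, IccExtend_of_mem _ _ ht, timeSuperposition]
  have hg : ContDiffOn ℝ ∞ (fun z => avg (timeSuperposition P (u z))) (Metric.ball 0 ρ) :=
    (avg.contDiff.comp (contDiff_timeSuperposition hPs)).comp_contDiffOn hu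
  have hG : ∀ v s, HasDerivAt (fun s => ∫ t in (0 : ℝ)..s, ψ v t) (ψ v s) s := fun v s =>
    intervalIntegral.integral_hasDerivAt_right ((hψ v).intervalIntegrable _ _)
      ((hψ v).stronglyMeasurableAtFilter _ _) (hψ v).continuousAt
  have hext1 : ∀ v : C(I, E), IccExtend zero_le_one v (1 : ℝ) = v 1 := fun v =>
    IccExtend_right _ _
  refine ⟨ρ, hρ, fun z => avg (timeSuperposition P (u z)), hg, ?_, fun z hz => ?_, fun r hr => ?_⟩
  · beta_reduce
    rw [havg, hu0]
    have : ψ 0 = fun _ => 0 := by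
      funext t
      simp [ψ, P, IccExtend]
    simp [this]
  · obtain ⟨hzδ, hzray, hz1⟩ := hray z hz
    obtain ⟨c, hc, hc'⟩ := hzray.exists_curve hK.continuous
    obtain ⟨c', hcder, hceq⟩ := hc' 1 (right_mem_Icc.2 zero_le_one)
    have hcz : c 1 = z := by
      rw [hc 1 (right_mem_Icc.2 zero_le_one), hext1, one_smul, hz1]
    have hgc : ∀ l ∈ Icc (0 : ℝ) 1, avg (timeSuperposition P (u (c l))) =
        ∫ t in (0 : ℝ)..l, ψ (u z) t := by
      intro l hl
      obtain ⟨w, hwray, hwle, hw⟩ := hzray.exists_rescale hK.continuous hl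
      have hw1 : w 1 = c l := by
        rw [hw, hc l hl]
        simp
      rw [← hw1, huniq w (hwle.trans_lt hzδ) hwray, havg]
      have hcomp := intervalIntegral.smul_integral_comp_mul_left (a := 0) (b := 1) (ψ (u z)) l
      rw [mul_zero, mul_one] at hcomp
      rw [← hcomp, ← intervalIntegral.integral_smul]
      refine intervalIntegral.integral_congr fun t ht => ?_
      rw [uIcc_of_le zero_le_one] at ht
      have hwt : IccExtend zero_le_one w t = l • IccExtend zero_le_one (u z) (l * t) :=
        (IccExtend_of_mem _ _ ht).trans (hw _)
      simp only [ψ, P, hwt, ContinuousMap.coe_mk, map_smul, smul_smul]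
      rw [mul_comm t l]
    have hgz : DifferentiableAt ℝ (fun z => avg (timeSuperposition P (u z))) (c 1) := by
      rw [hcz]
      exact (hg.differentiableOn (by simp)).differentiableAt (Metric.isOpen_ball.mem_nhds hz)
    have h1 := (hgz.hasFDerivAt.comp_hasDerivAt (1 : ℝ) hcder).hasDerivWithinAt (s := Icc 0 1)
    have h2 := ((hG (u z) 1).hasDerivWithinAt (s := Icc 0 1)).congr hgc
      (hgc 1 (right_mem_Icc.2 zero_le_one))
    have h3 := (uniqueDiffOn_Icc zero_lt_one 1 (right_mem_Icc.2 zero_le_one)).eq_deriv _ h1 h2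
    have hc'z : c' = z + b z := by rw [hbK, ← hcz, ← hceq, one_smul]
    have hψ1 := hψf (u z) 1
    rw [hext1, hz1, one_smul, Complex.ofReal_one, one_mul] at hψ1
    rwa [hcz, hc'z, hψ1] at h3
  · have hsmall : ∀ᶠ z in 𝓝 (0 : E), ‖u z‖ < r := by
      have hcont := (hu.continuousOn.continuousAt (Metric.ball_mem_nhds 0 hρ)).norm
      refine hcont.eventually_lt_const ?_
      simpa [hu0] using hr
    obtain ⟨ε, hε, hεsub⟩ := Metric.mem_nhds_iff.1 hsmall
    refine ⟨min r (min ε ρ), lt_min hr (lt_min hε hρ), min_le_left _ _, fun a ha ha0 heq z hz => ?_⟩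
    have hz' : z ∈ Metric.ball (0 : E) ε ∧ z ∈ Metric.ball (0 : E) ρ := by
      simp only [Metric.mem_ball, lt_min_iff] at hz
      exact hz.2
    obtain ⟨-, hzray, hz1⟩ := hray z hz'.2
    have hur : ‖u z‖ < r := hεsub hz'.1
    obtain ⟨c, hc, hc'⟩ := hzray.exists_curve hK.continuous
    have hcr : ∀ s ∈ Icc (0 : ℝ) 1, c s ∈ Metric.ball (0 : E) r := fun s hs => by
      rw [mem_ball_zero_iff, hc s hs, norm_smul, Real.norm_of_nonneg hs.1]
      exact (mul_le_of_le_one_left (norm_nonneg _) hs.2).trans_lt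
        (((u z).norm_coe_le_norm _).trans_lt hur)
    set S : ℝ → ℂ := fun s => ∫ t in (0 : ℝ)..s, ψ (u z) t
    have hac : ∀ s ∈ Icc (0 : ℝ) 1, DifferentiableAt ℝ a (c s) := fun s hs =>
      ha.differentiableAt (Metric.isOpen_ball.mem_nhds (hcr s hs))
    have hcontOn : ContinuousOn (fun s => a (c s) * Complex.exp (-S s)) (Icc 0 1) := by
      intro s hs
      obtain ⟨c', hcder, -⟩ := hc' s hs
      exact (((hac s hs).continuousAt.comp hcder.continuousAt).mul
        (hG (u z) s).continuousAt.neg.cexp).continuousWithinAt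
    have hder : ∀ s ∈ Ioo (0 : ℝ) 1,
        HasDerivAt (fun s => a (c s) * Complex.exp (-S s)) 0 s := by
      intro s hs
      have hs' := Ioo_subset_Icc_self hs
      obtain ⟨c', hcder, hceq⟩ := hc' s hs'
      have hs0 : (s : ℂ) ≠ 0 := by exact_mod_cast hs.1.ne'
      have hval : fderiv ℝ a (c s) c' = ψ (u z) s * a (c s) := by
        have h1 := heq (c s) (hcr s hs')
        rw [hbK, ← hceq, map_smul, Complex.real_smul, hc s hs', ← hψf, ← hc s hs', mul_assoc] at h1
        exact mul_left_cancel₀ hs0 h1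
      have h2 := ((hac s hs').hasFDerivAt.comp_hasDerivAt s hcder).mul (hG (u z) s).neg.cexp
      refine h2.congr_deriv ?_
      rw [hval]
      simp only [Function.comp_apply]
      ring
    have hftc := intervalIntegral.integral_eq_sub_of_hasDerivAt_of_le zero_le_one hcontOn hder
      intervalIntegrable_const
    have hc0 : c 0 = 0 := by simp [hc 0 (left_mem_Icc.2 zero_le_one)]
    have hcz : c 1 = z := by
      rw [hc 1 (right_mem_Icc.2 zero_le_one), hext1, one_smul, hz1]
    have hS0 : S 0 = 0 := intervalIntegral.integral_same
    rw [intervalIntegral.integral_zero, hc0, hcz, ha0, hS0, neg_zero, Complex.exp_zero, one_mul,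
      eq_comm, sub_eq_zero, Complex.exp_neg, mul_inv_eq_one₀ (Complex.exp_ne_zero _)] at hftc
    rw [hftc]
    beta_reduce
    rw [havg]

/-- A function smooth on a neighbourhood of a point agrees near that point with a globally smooth
function. -/
theorem exists_contDiff_eventuallyEq {E F : Type*} [NormedAddCommGroup E] [InnerProductSpace ℝ E]
    [NormedAddCommGroup F] [NormedSpace ℝ F] {s : Set E} (hs : IsOpen s) {x : E} (hx : x ∈ s)
    {f : E → F} (hf : ContDiffOn ℝ ∞ f s) :
    ∃ g : E → F, ContDiff ℝ ∞ g ∧ g =ᶠ[𝓝 x] f := by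
  obtain ⟨R, hR, hRs⟩ := Metric.isOpen_iff.1 hs x hx
  let χ : ContDiffBump x := ⟨R / 3, R / 2, by positivity, by linarith⟩
  refine ⟨fun y => χ y • f y, contDiff_iff_contDiffAt.2 fun y => ?_, ?_⟩
  · by_cases hy : y ∈ s
    · exact χ.contDiffAt.smul (hf.contDiffAt (hs.mem_nhds hy))
    · have hy' : y ∉ tsupport χ := by
        rw [χ.tsupport_eq]
        intro h
        exact hy (hRs (lt_of_le_of_lt h (by change R / 2 < R; linarith)))
      have : (fun y => χ y • f y) =ᶠ[𝓝 y] fun _ => 0 := by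
        filter_upwards [notMem_tsupport_iff_eventuallyEq.1 hy'] with w hw
        simp [hw]
      exact contDiffAt_const.congr_of_eventuallyEq this
  · filter_upwards [χ.eventuallyEq_one] with y hy
    simp [hy]

theorem sum_mul_apply_single {n : ℕ} (L : EuclideanSpace ℝ (Fin n) →L[ℝ] ℂ)
    (v w : EuclideanSpace ℝ (Fin n)) :
    ∑ i : Fin n, ((v i + w i : ℝ) : ℂ) * L (EuclideanSpace.single i 1) = L (v + w) := by
  conv_rhs => rw [← (EuclideanSpace.basisFun (Fin n) ℝ).sum_repr (v + w), map_sum]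
  simp

/-- Solvability and local uniqueness of the first transport equation of the WKB
construction near the diagonal: for `b` smooth vanishing to second order at `0` and
`f` smooth with `f(0)=0`, there is a smooth local solution `a` with `a(0)=1` of
`Σᵢ (zᵢ + bᵢ(z)) ∂a/∂zᵢ = f·a`, and any two such solutions agree near `0`. -/
theorem stmt3 (n : ℕ) (hn : 1 ≤ n) (Ω : Set (EuclideanSpace ℝ (Fin n)))
    (hΩ : IsOpen Ω) (h0 : (0 : EuclideanSpace ℝ (Fin n)) ∈ Ω)
    (b : EuclideanSpace ℝ (Fin n) → EuclideanSpace ℝ (Fin n))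
    (hb : ContDiffOn ℝ (⊤ : ℕ∞) b Ω) (hb0 : b 0 = 0) (hDb : fderiv ℝ b 0 = 0)
    (f : EuclideanSpace ℝ (Fin n) → ℂ) (hf : ContDiffOn ℝ (⊤ : ℕ∞) f Ω) (hf0 : f 0 = 0) :
    (∃ r > (0 : ℝ), Metric.ball 0 r ⊆ Ω ∧
      ∃ a : EuclideanSpace ℝ (Fin n) → ℂ,
        ContDiffOn ℝ (⊤ : ℕ∞) a (Metric.ball 0 r) ∧ a 0 = 1 ∧
        ∀ z ∈ Metric.ball (0 : EuclideanSpace ℝ (Fin n)) r,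
          ∑ i : Fin n, ((z i + b z i : ℝ) : ℂ) * fderiv ℝ a z (EuclideanSpace.single i 1)
            = f z * a z) ∧
    (∀ r > (0 : ℝ), Metric.ball (0 : EuclideanSpace ℝ (Fin n)) r ⊆ Ω →
      ∀ a₁ a₂ : EuclideanSpace ℝ (Fin n) → ℂ,
        ContDiffOn ℝ (⊤ : ℕ∞) a₁ (Metric.ball 0 r) → ContDiffOn ℝ (⊤ : ℕ∞) a₂ (Metric.ball 0 r) →
        a₁ 0 = 1 → a₂ 0 = 1 →
        (∀ z ∈ Metric.ball (0 : EuclideanSpace ℝ (Fin n)) r,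
          ∑ i : Fin n, ((z i + b z i : ℝ) : ℂ) * fderiv ℝ a₁ z (EuclideanSpace.single i 1)
            = f z * a₁ z) →
        (∀ z ∈ Metric.ball (0 : EuclideanSpace ℝ (Fin n)) r,
          ∑ i : Fin n, ((z i + b z i : ℝ) : ℂ) * fderiv ℝ a₂ z (EuclideanSpace.single i 1)
            = f z * a₂ z) →
        ∃ r' > (0 : ℝ), r' ≤ r ∧
          ∀ z ∈ Metric.ball (0 : EuclideanSpace ℝ (Fin n)) r', a₁ z = a₂ z) := by
  simp only [sum_mul_apply_single]
  obtain ⟨b', hb', hbb'⟩ := exists_contDiff_eventuallyEq hΩ h0 hb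
  obtain ⟨f', hf', hff'⟩ := exists_contDiff_eventuallyEq hΩ h0 hf
  obtain ⟨R, hR, hRsub⟩ := Metric.mem_nhds_iff.1
    (Filter.inter_mem (hΩ.mem_nhds h0) (hbb'.and hff'))
  obtain ⟨ρ, hρ, g, hg, hg0, hgeq, huniq⟩ := exists_transport_phase hb'
    (hbb'.eq_of_nhds.trans hb0) (hbb'.fderiv_eq.trans hDb) hf' (hff'.eq_of_nhds.trans hf0)
  refine ⟨⟨min ρ R, lt_min hρ hR, ?_, fun z => Complex.exp (g z), ?_, by simp [hg0], ?_⟩, ?_⟩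
  · exact fun z hz => (hRsub (Metric.ball_subset_ball (min_le_right _ _) hz)).1
  · exact (hg.mono (Metric.ball_subset_ball (min_le_left _ _))).cexp
  · intro z hz
    have hzρ := Metric.ball_subset_ball (min_le_left ρ R) hz
    obtain ⟨-, hbz, hfz⟩ := hRsub (Metric.ball_subset_ball (min_le_right _ _) hz)
    have hdiff : DifferentiableAt ℝ g z :=
      (hg.differentiableOn (by simp)).differentiableAt (Metric.isOpen_ball.mem_nhds hzρ)
    rw [hdiff.hasFDerivAt.cexp.fderiv, smul_apply, ← hbz, hgeq z hzρ, hfz,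
      smul_eq_mul, mul_comm]
  · intro r hr _ a₁ a₂ ha₁ ha₂ h₁ h₂ heq₁ heq₂
    obtain ⟨r', hr', hr'le, hexp⟩ := huniq (min r R) (lt_min hr hR)
    have hsol : ∀ a : EuclideanSpace ℝ (Fin n) → ℂ,
        ContDiffOn ℝ (⊤ : ℕ∞) a (Metric.ball 0 r) → a 0 = 1 →
        (∀ z ∈ Metric.ball (0 : EuclideanSpace ℝ (Fin n)) r,
          fderiv ℝ a z (z + b z) = f z * a z) →
        ∀ z ∈ Metric.ball (0 : EuclideanSpace ℝ (Fin n)) r', a z = Complex.exp (g z) := by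
      intro a ha h heq
      refine hexp a ((ha.differentiableOn (by simp)).mono
        (Metric.ball_subset_ball (min_le_left _ _))) h fun z hz => ?_
      obtain ⟨-, hbz, hfz⟩ := hRsub (Metric.ball_subset_ball (min_le_right _ _) hz)
      rw [hbz, hfz]
      exact heq z (Metric.ball_subset_ball (min_le_left _ _) hz)
    exact ⟨r', hr', hr'le.trans (min_le_left _ _), fun z hz =>
      (hsol a₁ ha₁ h₁ heq₁ z hz).trans (hsol a₂ ha₂ h₂ heq₂ z hz).symm⟩
end

section
/- Assume H is as in the rescaled bicharacteristic system, and suppose there exist ε, c, C > 0 such that for all x ∈ [0,ε), y ∈ ℝ^{n−1} and μ ∈ ℝ^{n−1}: ⟨H(x,y)μ, μ⟩ ≥ c‖μ‖² and |⟨∂ₓH(x,y)μ, μ⟩| ≤ C‖μ‖². Let (x, y, λ, μ, ξ) be a C¹ solution of the rescaled bicharacteristic system on [0,∞) with x(t) > 0 for all t ≥ 0 and inf_{t≥0} x(t) = 0. Then, as t → ∞: x(t) → 0, λ(t) → −1, μ(t) → 0 and ξ(t) → 0. -/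
open Filter Set

noncomputable section

/-- Apply a matrix `A : Fin d → Fin d → ℝ` to a vector. -/
def appF {d : ℕ} (A : Fin d → Fin d → ℝ) (v : Fin d → ℝ) : Fin d → ℝ :=
  fun i => ∑ j, A i j * v j

/-- Euclidean dot product on `Fin d → ℝ`. -/
def dotF {d : ℕ} (v w : Fin d → ℝ) : ℝ := ∑ i, v i * w i

/-- The partial derivative `∂ₓH`. -/
def Hx' {d : ℕ} (H : ℝ → (Fin d → ℝ) → (Fin d → Fin d → ℝ)) (x : ℝ) (y : Fin d → ℝ) :
    Fin d → Fin d → ℝ :=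
  fderiv ℝ (fun p : ℝ × (Fin d → ℝ) => H p.1 p.2) (x, y) (1, 0)

/-- The partial derivative `∂_{yᵢ}H`. -/
def Hy' {d : ℕ} (H : ℝ → (Fin d → ℝ) → (Fin d → Fin d → ℝ)) (i : Fin d) (x : ℝ)
    (y : Fin d → ℝ) : Fin d → Fin d → ℝ :=
  fderiv ℝ (fun p : ℝ × (Fin d → ℝ) => H p.1 p.2) (x, y) (0, Pi.single i 1)

/-- `(x, y, λ, μ, ξ)` is a solution of the rescaled bicharacteristic system for `H`
on the set `I`:  `x' = λx`, `y' = Hμ`, `λ' = λ + λ² − ⟨Hμ,μ⟩ − (x/2)⟨∂ₓH μ,μ⟩`,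
`μᵢ' = (1+2λ)μᵢ − (1/2)⟨∂_{yᵢ}H μ,μ⟩`, `ξ' = (1+2λ)ξ`. -/
def IsBicharSol {d m : ℕ} (H : ℝ → (Fin d → ℝ) → (Fin d → Fin d → ℝ))
    (x lam : ℝ → ℝ) (y μ : ℝ → Fin d → ℝ) (ξ : ℝ → Fin m → ℝ) (I : Set ℝ) : Prop :=
  ∀ t ∈ I,
    HasDerivAt x (lam t * x t) t ∧
    HasDerivAt y (appF (H (x t) (y t)) (μ t)) t ∧
    HasDerivAt lam (lam t + (lam t) ^ 2 - dotF (appF (H (x t) (y t)) (μ t)) (μ t)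
      - x t / 2 * dotF (appF (Hx' H (x t) (y t)) (μ t)) (μ t)) t ∧
    (∀ i, HasDerivAt (fun s => μ s i)
      ((1 + 2 * lam t) * μ t i
        - 1 / 2 * dotF (appF (Hy' H i (x t) (y t)) (μ t)) (μ t)) t) ∧
    HasDerivAt ξ ((1 + 2 * lam t) • ξ t) t

end

lemma antitoneOn_Ici_of_hasDerivAt_nonpos {f f' : ℝ → ℝ} {a : ℝ}
    (hf : ∀ t, a ≤ t → HasDerivAt f (f' t) t) (hf' : ∀ t, a ≤ t → f' t ≤ 0) :
    AntitoneOn f (Ici a) := by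
  refine antitoneOn_of_deriv_nonpos (convex_Ici a)
    (fun t ht => (hf t ht).continuousAt.continuousWithinAt)
    (fun t ht => (hf t (interior_subset ht)).differentiableAt.differentiableWithinAt)
    (fun t ht => ?_)
  rw [(hf t (interior_subset ht)).deriv]
  exact hf' t (interior_subset ht)

lemma eq_of_hasDerivAt_zero_Ici {E : Type*} [NormedAddCommGroup E] [NormedSpace ℝ E]
    {f : ℝ → E} {a : ℝ} (hf : ∀ t, a ≤ t → HasDerivAt f 0 t) {t : ℝ} (ht : a ≤ t) :
    f t = f a :=
  constant_of_has_deriv_right_zero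
    (fun s hs => (hf s hs.1).continuousAt.continuousWithinAt)
    (fun s hs => (hf s hs.1).hasDerivWithinAt) t ⟨ht, le_rfl⟩

/-- A function that starts negative stays negative if its derivative is negative at any first
zero. -/
lemma neg_of_hasDerivAt_neg_at_first_zero {f f' : ℝ → ℝ} {a : ℝ}
    (hf : ∀ t, a ≤ t → HasDerivAt f (f' t) t) (ha : f a < 0)
    (hzero : ∀ s, a < s → (∀ t, a ≤ t → t < s → f t < 0) → f s = 0 → f' s < 0) :
    ∀ t, a ≤ t → f t < 0 := by
  intro b hab
  by_contra! hb
  have hcont : ContinuousOn f (Icc a b) :=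
    fun t ht => (hf t ht.1).continuousAt.continuousWithinAt
  have hclosed : IsClosed (Icc a b ∩ f ⁻¹' Ici 0) :=
    hcont.preimage_isClosed_of_isClosed isClosed_Icc isClosed_Ici
  obtain ⟨s, ⟨hs, hfs⟩, hmin⟩ := (isCompact_Icc.of_isClosed_subset hclosed
    inter_subset_left).exists_isLeast ⟨b, ⟨hab, le_rfl⟩, hb⟩
  have hbefore : ∀ t, a ≤ t → t < s → f t < 0 := by
    intro t hat hts
    by_contra! h
    exact absurd (hmin ⟨⟨hat, hts.le.trans hs.2⟩, h⟩) (not_le.2 hts)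
  have has : a < s := by
    rcases hs.1.eq_or_lt with h | h
    · rw [← h] at hfs
      exact absurd ha (not_lt.2 hfs)
    · exact h
  have hnear : ∀ᶠ t in nhdsWithin s (Iio s), f t < 0 := by
    filter_upwards [Ioo_mem_nhdsLT has] with t ht
    exact hbefore t ht.1.le ht.2
  have hfs0 : f s = 0 := le_antisymm
    (le_of_tendsto ((hf s hs.1).continuousAt.tendsto.mono_left nhdsWithin_le_nhds) (hnear.mono fun _ h => h.le)) hfs
  have hslope := (hasDerivAt_iff_tendsto_slope.1 (hf s hs.1)).mono_left
    (nhdsWithin_mono s (show Iio s ⊆ {s}ᶜ from fun t ht => ne_of_lt ht))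
  have hnonneg : 0 ≤ f' s := by
    refine ge_of_tendsto hslope ?_
    filter_upwards [hnear, self_mem_nhdsWithin] with t ht hts
    rw [slope_def_field, hfs0, sub_zero]
    exact div_nonneg_of_nonpos ht.le (sub_nonpos.2 (le_of_lt hts))
  exact absurd (hzero s has hbefore hfs0) (not_lt.2 hnonneg)

lemma eventually_le_of_hasDerivAt_neg_add {u g : ℝ → ℝ} {a L e : ℝ}
    (hu : ∀ t, a ≤ t → HasDerivAt u (-u t + g t) t) (he : 0 < e)
    (hg : ∀ᶠ t in atTop, g t ≤ L) : ∀ᶠ t in atTop, u t < L + e := by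
  obtain ⟨T, hT⟩ := eventually_atTop.1 hg
  have hanti : AntitoneOn (fun t => Real.exp t * (u t - L)) (Ici (max a T)) := by
    refine antitoneOn_Ici_of_hasDerivAt_nonpos (f' := fun t => Real.exp t * (g t - L))
      (fun t ht => ?_) (fun t ht => ?_)
    · refine ((Real.hasDerivAt_exp t).mul
        ((hu t ((le_max_left _ _).trans ht)).sub_const L)).congr_deriv ?_
      ring
    · exact mul_nonpos_of_nonneg_of_nonpos (Real.exp_pos t).le
        (sub_nonpos.2 (hT t ((le_max_right _ _).trans ht)))
  set M := Real.exp (max a T) * (u (max a T) - L)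
  filter_upwards [eventually_ge_atTop (max a T),
    Real.tendsto_exp_atTop.eventually_gt_atTop (M / e)] with t ht hM
  have h1 : Real.exp t * (u t - L) ≤ M := hanti self_mem_Ici ht ht
  rw [div_lt_iff₀ he] at hM
  have h2 := lt_of_mul_lt_mul_left (h1.trans_lt hM) (Real.exp_pos t).le
  linarith

/-- If `u' = -u + g` and `g → L`, then `u → L`. -/
lemma tendsto_of_hasDerivAt_neg_add {u g : ℝ → ℝ} {a L : ℝ}
    (hu : ∀ t, a ≤ t → HasDerivAt u (-u t + g t) t)
    (hg : Tendsto g atTop (nhds L)) : Tendsto u atTop (nhds L) := by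
  refine Metric.tendsto_nhds.2 fun e he => ?_
  have hup := eventually_le_of_hasDerivAt_neg_add (L := L + e / 2) hu (half_pos he)
    (hg.eventually_le_const (by linarith))
  have hlow := eventually_le_of_hasDerivAt_neg_add (u := fun t => -u t) (g := fun t => -g t)
    (L := -L + e / 2) (fun t ht => (hu t ht).neg.congr_deriv (by ring)) (half_pos he)
    (hg.neg.eventually_le_const (by linarith))
  filter_upwards [hup, hlow] with t h1 h2
  rw [Real.dist_eq, abs_lt]
  constructor <;> linarith

/-- If a positive solution of `x' = λ x` takes values arbitrarily close to `0`, then `λ` is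
negative at some point where `x` is small. -/
lemma exists_lt_and_neg_of_hasDerivAt_mul {x lam : ℝ → ℝ} {δ : ℝ} (hδ : 0 < δ)
    (hx : ∀ t, 0 ≤ t → HasDerivAt x (lam t * x t) t) (hxpos : ∀ t, 0 ≤ t → 0 < x t)
    (hsmall : ∀ e > 0, ∃ t, 0 ≤ t ∧ x t < e) :
    ∃ t, 0 ≤ t ∧ x t < δ ∧ lam t < 0 := by
  by_contra! h
  obtain ⟨e, he0, he⟩ := exists_between (lt_min hδ (hxpos 0 le_rfl))
  obtain ⟨T, hT0, hT⟩ := hsmall e he0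
  have hcont : ContinuousOn x (Icc 0 T) :=
    fun t ht => (hx t ht.1).continuousAt.continuousWithinAt
  have hclosed : IsClosed (Icc 0 T ∩ x ⁻¹' Ici e) :=
    hcont.preimage_isClosed_of_isClosed isClosed_Icc isClosed_Ici
  obtain ⟨s, ⟨hs, hxs⟩, hmax⟩ := (isCompact_Icc.of_isClosed_subset hclosed
    inter_subset_left).exists_isGreatest
    ⟨0, ⟨le_rfl, hT0⟩, (he.trans_le (min_le_right _ _)).le⟩
  have hsT : s < T := by
    rcases hs.2.eq_or_lt with h' | h'
    · rw [h'] at hxs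
      exact absurd hT (not_lt.2 hxs)
    · exact h'
  obtain ⟨r, hr, hslope⟩ := exists_hasDerivAt_eq_slope x (fun t => lam t * x t) hsT
    (hcont.mono (Icc_subset_Icc_left hs.1)) (fun t ht => hx t (hs.1.trans ht.1.le))
  have hr0 : 0 ≤ r := hs.1.trans hr.1.le
  have hxr : x r < e := by
    by_contra! h'
    exact absurd (hmax ⟨⟨hr0, hr.2.le⟩, h'⟩) (not_le.2 hr.1)
  have h1 := mul_nonneg (h r hr0 (hxr.trans (he.trans_le (min_le_left _ _)))) (hxpos r hr0).le
  have h2 : (x T - x s) / (T - s) < 0 :=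
    div_neg_of_neg_of_pos (sub_neg.2 (hT.trans_le hxs)) (sub_pos.2 hsT)
  linarith

/-- The reduced flow in `x`, `λ`, `q = ⟨Hμ, μ⟩` and `p = ⟨∂ₓH μ, μ⟩`. -/
lemma tendsto_of_reduced_flow {x lam q p : ℝ → ℝ} {δ : ℝ} (hδ : 0 < δ)
    (hx : ∀ t, 0 ≤ t → HasDerivAt x (lam t * x t) t)
    (hlam : ∀ t, 0 ≤ t → HasDerivAt lam (lam t + lam t ^ 2 - q t - x t / 2 * p t) t)
    (hq : ∀ t, 0 ≤ t → HasDerivAt q (2 * (1 + 2 * lam t) * q t + lam t * x t * p t) t)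
    (hxpos : ∀ t, 0 ≤ t → 0 < x t)
    (hsmall : ∀ e > 0, ∃ t, 0 ≤ t ∧ x t < e)
    (hq0 : ∀ t, 0 ≤ t → x t < δ → 0 ≤ q t)
    (hqp : ∀ t, 0 ≤ t → x t < δ → q t / 2 ≤ q t + x t / 2 * p t) :
    Tendsto x atTop (nhds 0) ∧ Tendsto lam atTop (nhds (-1)) ∧ Tendsto q atTop (nhds 0) ∧
      ∃ K, Tendsto (fun t => Real.exp t * x t) atTop (nhds K) := by
  obtain ⟨a, ha0, hxa, hla⟩ := exists_lt_and_neg_of_hasDerivAt_mul hδ hx hxpos hsmall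
  have hE0 : 0 < lam a ^ 2 + q a := by
    have := hq0 a ha0 hxa
    have := pow_pos (neg_pos.2 hla) 2
    nlinarith
  set A := x a * Real.exp a / √(lam a ^ 2 + q a) with hA
  have hApos : 0 < A := by have := hxpos a ha0; positivity
  set u : ℝ → ℝ := fun t => A * (Real.exp (-t) / x t) with hu_def
  have hupos : ∀ t, 0 ≤ t → 0 < u t := fun t ht => by
    have := hxpos t ht; simp only [hu_def]; positivity
  have hu : ∀ t, 0 ≤ t → HasDerivAt u (-u t - lam t * u t) t := fun t ht => by
    have hxt := (hxpos t ht).ne'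
    refine (((hasDerivAt_neg t).exp.div (hx t ht) hxt).const_mul A).congr_deriv ?_
    simp only [hu_def]
    field_simp
  have hEu : ∀ t, a ≤ t → (lam t ^ 2 + q t) * u t ^ 2 = 1 := by
    intro t ht
    have hconst := eq_of_hasDerivAt_zero_Ici
      (f := fun t => (lam t ^ 2 + q t) * u t ^ 2) (a := a) (fun s hs => by
        have hs0 := ha0.trans hs
        refine ((((hlam s hs0).pow 2).add (hq s hs0)).mul
          ((hu s hs0).pow 2)).congr_deriv ?_
        simp only [Pi.add_apply, Pi.pow_apply]
        norm_num
        ring) ht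
    rw [hconst]
    have hxa' := (hxpos a ha0).ne'
    have hua : u a = 1 / √(lam a ^ 2 + q a) := by
      simp only [hu_def, hA, Real.exp_neg]
      field_simp
    rw [hua, div_pow, Real.sq_sqrt hE0.le]
    field_simp
  have hanti_of : ∀ s, (∀ t, a ≤ t → t < s → lam t < 0) → ∀ t ∈ Icc a s, x t < δ := by
    intro s hs t ht
    refine lt_of_le_of_lt ?_ hxa
    refine antitoneOn_of_deriv_nonpos (convex_Icc a s)
      (fun r hr => (hx r (ha0.trans hr.1)).continuousAt.continuousWithinAt)
      (fun r hr => (hx r (ha0.trans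
        (interior_subset hr).1)).differentiableAt.differentiableWithinAt)
      (fun r hr => ?_) (left_mem_Icc.2 (ht.1.trans ht.2)) ht ht.1
    rw [interior_Icc] at hr
    have hr0 := ha0.trans hr.1.le
    rw [(hx r hr0).deriv]
    exact mul_nonpos_of_nonpos_of_nonneg (hs r hr.1.le hr.2).le (hxpos r hr0).le
  have hneg : ∀ t, a ≤ t → lam t < 0 := by
    refine neg_of_hasDerivAt_neg_at_first_zero (fun t ht => hlam t (ha0.trans ht)) hla ?_
    intro s has hbefore hs
    have hxs := hanti_of s hbefore s ⟨has.le, le_rfl⟩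
    have hs0 := ha0.trans has.le
    have h1 := hqp s hs0 hxs
    have h2 := hEu s has.le
    have h3 : 0 < q s := by
      rw [hs] at h2
      have := hq0 s hs0 hxs
      rcases this.eq_or_lt with h | h
      · rw [← h] at h2; norm_num at h2
      · exact h
    rw [hs]
    linarith
  have hxδ : ∀ t, a ≤ t → x t < δ := fun t ht =>
    hanti_of t (fun r hr _ => hneg r hr) t ⟨ht, le_rfl⟩
  have hxanti : AntitoneOn x (Ici a) :=
    antitoneOn_Ici_of_hasDerivAt_nonpos (fun t ht => hx t (ha0.trans ht)) fun t ht =>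
      mul_nonpos_of_nonpos_of_nonneg (hneg t ht).le (hxpos t (ha0.trans ht)).le
  have hx0 : Tendsto x atTop (nhds 0) := by
    obtain ⟨b, hb, hbmin⟩ := isCompact_Icc.exists_isMinOn (nonempty_Icc.2 ha0)
      (f := x) (fun t ht => (hx t ht.1).continuousAt.continuousWithinAt)
    refine Metric.tendsto_nhds.2 fun e he => ?_
    obtain ⟨T, hT0, hT⟩ := hsmall (min e (x b)) (lt_min he (hxpos b hb.1))
    have haT : a ≤ T := by
      by_contra! h
      have : x b ≤ x T := hbmin ⟨hT0, h.le⟩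
      exact absurd (hT.trans_le (min_le_right _ _)) (not_lt.2 this)
    filter_upwards [eventually_ge_atTop T] with t ht
    rw [Real.dist_eq, sub_zero, abs_of_pos (hxpos t (hT0.trans ht))]
    exact (hxanti haT (haT.trans ht) ht).trans_lt (hT.trans_le (min_le_left _ _))
  set w : ℝ → ℝ := fun t => lam t * u t with hw_def
  have hw : ∀ t, a ≤ t → HasDerivAt w (-(q t + x t / 2 * p t) * u t) t := fun t ht => by
    refine ((hlam t (ha0.trans ht)).mul (hu t (ha0.trans ht))).congr_deriv ?_
    ring
  have hqu : ∀ t, a ≤ t → q t * u t ^ 2 = 1 - w t ^ 2 := fun t ht => by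
    have := hEu t ht
    simp only [hw_def]
    linarith
  have hwanti : AntitoneOn w (Ici a) :=
    antitoneOn_Ici_of_hasDerivAt_nonpos hw fun t ht => by
      have h1 := hqp t (ha0.trans ht) (hxδ t ht)
      have h2 := hq0 t (ha0.trans ht) (hxδ t ht)
      exact mul_nonpos_of_nonpos_of_nonneg (by linarith) (hupos t (ha0.trans ht)).le
  have hwge : ∀ t, a ≤ t → -1 ≤ w t := fun t ht => by
    have h1 := hqu t ht
    have h2 := mul_nonneg (hq0 t (ha0.trans ht) (hxδ t ht)) (sq_nonneg (u t))
    nlinarith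
  have hwa : w a < 0 := mul_neg_of_neg_of_pos hla (hupos a ha0)
  obtain ⟨W, hW⟩ : ∃ W, Tendsto w atTop (nhds W) := by
    have hmono : Antitone fun t => w (max a t) := fun s t hst =>
      hwanti (mem_Ici.2 (le_max_left a s)) (mem_Ici.2 (le_max_left a t)) (max_le_max_left a hst)
    have hbdd : BddBelow (range fun t => w (max a t)) :=
      ⟨-1, by rintro _ ⟨t, rfl⟩; exact hwge _ (le_max_left _ _)⟩
    refine ⟨_, (tendsto_atTop_ciInf hmono hbdd).congr' ?_⟩
    filter_upwards [eventually_ge_atTop a] with t ht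
    rw [max_eq_right ht]
  have hWle : ∀ t, a ≤ t → W ≤ w t := fun t ht => by
    refine le_of_tendsto hW ?_
    filter_upwards [eventually_ge_atTop t] with s hs
    exact hwanti ht (ht.trans hs) hs
  have hW0 : W < 0 := (hWle a le_rfl).trans_lt hwa
  have hWge : -1 ≤ W := by
    refine ge_of_tendsto hW ?_
    filter_upwards [eventually_ge_atTop a] with t ht using hwge t ht
  have huW : Tendsto u atTop (nhds (-W)) :=
    tendsto_of_hasDerivAt_neg_add (fun t ht => hu t (ha0.trans ht)) hW.neg
  have hW1 : W = -1 := by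
    by_contra hne
    have hW1 : -1 < W := lt_of_le_of_ne hWge (Ne.symm hne)
    obtain ⟨b, hb⟩ := eventually_atTop.1
      ((huW.eventually_le_const (show -W < 1 by linarith)).and (eventually_ge_atTop a))
    set k := (1 - W ^ 2) / 2 with hk
    have hkpos : 0 < k := by simp only [hk]; nlinarith
    have hanti : AntitoneOn (fun t => w t + k * t) (Ici b) := by
      refine antitoneOn_Ici_of_hasDerivAt_nonpos
        (fun t ht => (hw t (hb t ht).2).add ((hasDerivAt_id t).const_mul k)) fun t ht => ?_
      obtain ⟨hu1, hat⟩ := hb t ht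
      have ht0 := ha0.trans hat
      have h1 := hqp t ht0 (hxδ t hat)
      have h2 := hq0 t ht0 (hxδ t hat)
      have h3 := hqu t hat
      have h4 := hupos t ht0
      have h5 := hWle t hat
      have h6 : w t < 0 := mul_neg_of_neg_of_pos (hneg t hat) h4
      have h7 : w t ^ 2 ≤ W ^ 2 := by nlinarith
      have h8 : q t * u t ^ 2 ≤ q t * u t := by
        rw [pow_two]
        exact mul_le_mul_of_nonneg_left (by nlinarith) h2
      have h9 := mul_le_mul_of_nonneg_right h1 h4.le
      simp only [hk]
      linarith
    have hlim : Tendsto (fun t => k * t) atTop atTop := tendsto_id.const_mul_atTop hkpos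
    obtain ⟨t, ht, hbt⟩ := ((hlim.eventually_gt_atTop (w b + k * b + 1)).and
      (eventually_ge_atTop b)).exists
    have h1 := hanti self_mem_Ici hbt hbt
    have h2 := hwge t (hb t hbt).2
    simp only at h1
    linarith
  rw [hW1] at hW huW
  rw [neg_neg] at huW
  have hlim_lam : Tendsto lam atTop (nhds (-1)) := by
    have := hW.div huW one_ne_zero
    rw [div_one] at this
    refine this.congr' ?_
    filter_upwards [eventually_ge_atTop 0] with t ht
    simp only [hw_def, Pi.div_apply]
    exact mul_div_cancel_right₀ _ (hupos t ht).ne'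
  refine ⟨hx0, hlim_lam, ?_, A, ?_⟩
  · have := ((hW.pow 2).const_sub 1).div (huW.pow 2) (by norm_num)
    norm_num at this
    refine this.congr' ?_
    filter_upwards [eventually_ge_atTop a] with t ht
    have := (hupos t (ha0.trans ht)).ne'
    simp only [Pi.div_apply]
    rw [← hqu t ht]
    field_simp
  · have := (tendsto_const_nhds (x := A)).div huW one_ne_zero
    rw [div_one] at this
    refine this.congr' ?_
    filter_upwards [eventually_ge_atTop 0] with t ht
    have := (hxpos t ht).ne'
    simp only [hu_def, Real.exp_neg, Pi.div_apply]
    field_simp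

lemma dotF_self_nonneg {d : ℕ} (v : Fin d → ℝ) : 0 ≤ dotF v v :=
  Finset.sum_nonneg fun i _ => mul_self_nonneg (v i)

lemma dotF_appF {d : ℕ} (A : Fin d → Fin d → ℝ) (v w : Fin d → ℝ) :
    dotF (appF A v) w = ∑ i, ∑ j, A i j * v j * w i := by
  simp only [dotF, appF, Finset.sum_mul]

lemma fderiv_pair_apply {d : ℕ} (H : ℝ → (Fin d → ℝ) → (Fin d → Fin d → ℝ)) (x a : ℝ)
    (y v : Fin d → ℝ) :
    fderiv ℝ (fun p : ℝ × (Fin d → ℝ) => H p.1 p.2) (x, y) (a, v) =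
      a • Hx' H x y + ∑ i, v i • Hy' H i x y := by
  have hv : ((a, v) : ℝ × (Fin d → ℝ)) =
      a • ((1, 0) : ℝ × (Fin d → ℝ)) + ∑ i, v i • ((0, Pi.single i 1) : ℝ × (Fin d → ℝ)) := by
    ext j
    · simp [Prod.fst_sum]
    · simp [Prod.snd_sum, Finset.sum_apply, Pi.single_apply]
  rw [hv, map_add, map_sum, map_smul]
  simp only [map_smul, Hx', Hy']

/-- Along the flow, `⟨Hμ, μ⟩' = 2(1+2λ)⟨Hμ, μ⟩ + λx⟨∂ₓH μ, μ⟩`. -/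
lemma IsBicharSol.hasDerivAt_dotF {d m : ℕ} {H : ℝ → (Fin d → ℝ) → (Fin d → Fin d → ℝ)}
    (hH : ContDiff ℝ 1 (fun p : ℝ × (Fin d → ℝ) => H p.1 p.2))
    (hsymm : ∀ x y, ∀ i j, H x y i j = H x y j i)
    {x lam : ℝ → ℝ} {y μ : ℝ → Fin d → ℝ} {ξ : ℝ → Fin m → ℝ} {I : Set ℝ}
    (hsol : IsBicharSol H x lam y μ ξ I) {t : ℝ} (ht : t ∈ I) :
    HasDerivAt (fun s => dotF (appF (H (x s) (y s)) (μ s)) (μ s))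
      (2 * (1 + 2 * lam t) * dotF (appF (H (x t) (y t)) (μ t)) (μ t)
        + lam t * x t * dotF (appF (Hx' H (x t) (y t)) (μ t)) (μ t)) t := by
  obtain ⟨hx, hy, -, hμ, -⟩ := hsol t ht
  set v := appF (H (x t) (y t)) (μ t) with hv
  have hHt : HasDerivAt (fun s => H (x s) (y s))
      ((lam t * x t) • Hx' H (x t) (y t) + ∑ k, v k • Hy' H k (x t) (y t)) t := by
    rw [← fderiv_pair_apply]
    exact ((hH.differentiable one_ne_zero (x t, y t)).hasFDerivAt).comp_hasDerivAt t
      (hx.prodMk hy)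
  have hHij : ∀ i j, HasDerivAt (fun s => H (x s) (y s) i j)
      (lam t * x t * Hx' H (x t) (y t) i j + ∑ k, v k * Hy' H k (x t) (y t) i j) t := by
    intro i j
    refine (hasDerivAt_pi.1 (hasDerivAt_pi.1 hHt i) j).congr_deriv ?_
    simp [Finset.sum_apply]
  set μ' : Fin d → ℝ := fun i => (1 + 2 * lam t) * μ t i
        - 1 / 2 * dotF (appF (Hy' H i (x t) (y t)) (μ t)) (μ t) with hμ'
  have hsum : HasDerivAt (fun s => ∑ i, ∑ j, H (x s) (y s) i j * μ s j * μ s i)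
      (∑ i, ∑ j, (((lam t * x t * Hx' H (x t) (y t) i j
        + ∑ k, v k * Hy' H k (x t) (y t) i j) * μ t j + H (x t) (y t) i j * μ' j) * μ t i
        + H (x t) (y t) i j * μ t j * μ' i)) t :=
    HasDerivAt.fun_sum fun i _ => HasDerivAt.fun_sum fun j _ =>
      ((hHij i j).mul (hμ j)).mul (hμ i)
  simp only [dotF_appF] at hμ' ⊢
  refine hsum.congr_deriv ?_
  have hswap : ∑ i, ∑ j, H (x t) (y t) i j * μ' j * μ t i = ∑ i, v i * μ' i := by
    rw [Finset.sum_comm]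
    refine Finset.sum_congr rfl fun j _ => ?_
    rw [hv, appF, Finset.sum_mul]
    refine Finset.sum_congr rfl fun i _ => ?_
    rw [hsymm _ _ i j]
    ring
  have hdir : ∑ i, ∑ j, H (x t) (y t) i j * μ t j * μ' i = ∑ i, v i * μ' i := by
    refine Finset.sum_congr rfl fun i _ => ?_
    rw [hv, appF, Finset.sum_mul]
  have hvμ' : ∑ i, v i * μ' i = (1 + 2 * lam t) * dotF v (μ t)
      - 1 / 2 * ∑ k, v k * ∑ i, ∑ j, Hy' H k (x t) (y t) i j * μ t j * μ t i := by
    rw [dotF, Finset.mul_sum, Finset.mul_sum, ← Finset.sum_sub_distrib]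
    refine Finset.sum_congr rfl fun i _ => ?_
    rw [hμ']
    ring
  have hHy : ∑ i, ∑ j, (∑ k, v k * Hy' H k (x t) (y t) i j) * μ t j * μ t i
      = ∑ k, v k * ∑ i, ∑ j, Hy' H k (x t) (y t) i j * μ t j * μ t i := by
    simp only [Finset.sum_mul, Finset.mul_sum]
    rw [Finset.sum_comm (γ := Fin d) (s := Finset.univ) (t := Finset.univ)
      (f := fun k i => ∑ j, v k * (Hy' H k (x t) (y t) i j * μ t j * μ t i))]
    refine Finset.sum_congr rfl fun i _ => ?_
    rw [Finset.sum_comm]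
    refine Finset.sum_congr rfl fun k _ => Finset.sum_congr rfl fun j _ => ?_
    ring
  have hsplit : ∑ i, ∑ j, (((lam t * x t * Hx' H (x t) (y t) i j
        + ∑ k, v k * Hy' H k (x t) (y t) i j) * μ t j + H (x t) (y t) i j * μ' j) * μ t i
        + H (x t) (y t) i j * μ t j * μ' i)
      = lam t * x t * ∑ i, ∑ j, Hx' H (x t) (y t) i j * μ t j * μ t i
        + ∑ i, ∑ j, (∑ k, v k * Hy' H k (x t) (y t) i j) * μ t j * μ t i
        + ∑ i, ∑ j, H (x t) (y t) i j * μ' j * μ t i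
        + ∑ i, ∑ j, H (x t) (y t) i j * μ t j * μ' i := by
    simp only [Finset.mul_sum, ← Finset.sum_add_distrib]
    refine Finset.sum_congr rfl fun i _ => Finset.sum_congr rfl fun j _ => ?_
    ring
  rw [hsplit, hswap, hdir, hHy, hvμ']
  ring

/-- Lemma 3.2 of the paper: along every non-trapped ray of the rescaled
bicharacteristic system (for a `C¹` symmetric `H`, positive definite near the boundary
with bounded `∂ₓH`-quadratic form), one has `x → 0`, `λ → −1`, `μ → 0`, `ξ → 0`. -/
theorem stmt7 (n m : ℕ) (hn : 2 ≤ n) (hm : 1 ≤ m)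
    (H : ℝ → (Fin (n - 1) → ℝ) → (Fin (n - 1) → Fin (n - 1) → ℝ))
    (hH : ContDiff ℝ 1 (fun p : ℝ × (Fin (n - 1) → ℝ) => H p.1 p.2))
    (hsymm : ∀ x y, ∀ i j, H x y i j = H x y j i)
    (ε c C : ℝ) (hε : 0 < ε) (hc : 0 < c) (hC : 0 < C)
    (hpos : ∀ x ∈ Set.Ico (0 : ℝ) ε, ∀ y μ : Fin (n - 1) → ℝ,
      c * dotF μ μ ≤ dotF (appF (H x y) μ) μ)
    (hbd : ∀ x ∈ Set.Ico (0 : ℝ) ε, ∀ y μ : Fin (n - 1) → ℝ,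
      |dotF (appF (Hx' H x y) μ) μ| ≤ C * dotF μ μ)
    (x lam : ℝ → ℝ) (y μ : ℝ → Fin (n - 1) → ℝ) (ξ : ℝ → Fin m → ℝ)
    (hsol : IsBicharSol H x lam y μ ξ (Set.Ici 0))
    (hxpos : ∀ t : ℝ, 0 ≤ t → 0 < x t)
    (hinf : sInf (x '' Set.Ici 0) = 0) :
    Tendsto x atTop (nhds 0) ∧ Tendsto lam atTop (nhds (-1)) ∧
      Tendsto μ atTop (nhds 0) ∧ Tendsto ξ atTop (nhds 0) := by
  have hδ : 0 < min ε (c / C) := lt_min hε (div_pos hc hC)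
  have hsmall : ∀ e > 0, ∃ t, 0 ≤ t ∧ x t < e := fun e he => by
    obtain ⟨_, ⟨t, ht, rfl⟩, hlt⟩ := exists_lt_of_csInf_lt
      (Set.Nonempty.image x ⟨(0 : ℝ), self_mem_Ici⟩) (hinf.trans_lt he)
    exact ⟨t, ht, hlt⟩
  have hmem : ∀ t, 0 ≤ t → x t < min ε (c / C) → x t ∈ Ico (0 : ℝ) ε := fun t ht hxt =>
    ⟨(hxpos t ht).le, hxt.trans_le (min_le_left _ _)⟩
  obtain ⟨hx0, hlam, hq, K, hK⟩ := tendsto_of_reduced_flow hδ (fun t ht => (hsol t ht).1)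
    (fun t ht => (hsol t ht).2.2.1) (fun t ht => hsol.hasDerivAt_dotF hH hsymm ht)
    hxpos hsmall
    (fun t ht hxt => (mul_nonneg hc.le (dotF_self_nonneg (μ t))).trans
      (hpos _ (hmem t ht hxt) _ _))
    (fun t ht hxt => by
      have h1 := hpos _ (hmem t ht hxt) (y t) (μ t)
      have h2 := (abs_le.1 (hbd _ (hmem t ht hxt) (y t) (μ t))).1
      have h3 : x t * C ≤ c := (le_div_iff₀ hC).1 (hxt.trans_le (min_le_right _ _)).le
      have h4 := mul_le_mul_of_nonneg_left h2 (hxpos t ht).le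
      have h5 := mul_le_mul_of_nonneg_right h3 (dotF_self_nonneg (μ t))
      nlinarith)
  refine ⟨hx0, hlam, tendsto_pi_nhds.2 fun i => ?_, ?_⟩
  · have hsq : Tendsto (fun t => μ t i ^ 2) atTop (nhds 0) := by
      have hq' := hq.div_const c
      rw [zero_div] at hq'
      refine squeeze_zero' (Eventually.of_forall fun t => sq_nonneg _) ?_ hq'
      filter_upwards [eventually_ge_atTop 0, hx0.eventually_lt_const hδ] with t ht hxt
      rw [le_div_iff₀ hc]
      have h1 := hpos _ (hmem t ht hxt) (y t) (μ t)
      have h2 : μ t i ^ 2 ≤ dotF (μ t) (μ t) := by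
        rw [pow_two]
        exact Finset.single_le_sum (f := fun j => μ t j * μ t j)
          (fun j _ => mul_self_nonneg (μ t j)) (Finset.mem_univ i)
      nlinarith
    have habs := hsq.sqrt
    simp only [Real.sqrt_sq_eq_abs, Real.sqrt_zero] at habs
    exact (tendsto_zero_iff_abs_tendsto_zero _).2 habs
  · have hconst : ∀ t, 0 ≤ t →
        (Real.exp (-t) / x t ^ 2) • ξ t = (Real.exp (-0) / x 0 ^ 2) • ξ 0 := fun t ht =>
      eq_of_hasDerivAt_zero_Ici (f := fun t => (Real.exp (-t) / x t ^ 2) • ξ t)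
        (fun s hs => by
          have hxs := (hxpos s hs).ne'
          refine (((hasDerivAt_neg s).exp.div ((hsol s hs).1.pow 2)
            (pow_ne_zero 2 hxs)).smul (hsol s hs).2.2.2.2).congr_deriv ?_
          rw [smul_smul, ← add_smul]
          refine Eq.trans (congrArg (· • ξ s) ?_) (zero_smul ℝ (ξ s))
          simp
          field_simp
          ring) ht
    have hlim := (hK.mul hx0).smul_const ((Real.exp (-0) / x 0 ^ 2) • ξ 0)
    rw [mul_zero, zero_smul] at hlim
    refine hlim.congr' ?_
    filter_upwards [eventually_ge_atTop 0] with t ht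
    have hxt := (hxpos t ht).ne'
    rw [← hconst t ht, smul_smul, Real.exp_neg]
    convert one_smul ℝ (ξ t) using 2
    field_simp
end
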